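/- arXiv:2601.20393 — 3 statements merged into one kernel-verified Lean document; each statement's English description precedes it below -/
import Mathlib

section
/- Let m and k be natural numbers with k ≤ m, and let M be the real matrix indexed by pairs of Boolean strings x, y of length m, whose (x,y) entry equals 1 if ham(x) + ham(y) = k and 0 otherwise. Then the rank of M equals k + 1. -/
/-- Hamming weight of a Boolean string: number of coordinates equal to `true`. -/
def ham {m : ℕ} (x : Fin m → Bool) : ℕ :=
  (Finset.univ.filter fun i => x i = true).card

theorem ham_decide_lt {m j : ℕ} (hj : j ≤ m) :
    ham (fun i : Fin m => decide ((i : ℕ) < j)) = j := by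
  simp [ham, Fin.card_filter_val_lt, hj]

/-- The state matrix of the Dicke state `D(2m, k)` has rank exactly `k + 1`
when `k ≤ m`. -/
theorem dicke_state_matrix_rank (m k : ℕ) (hk : k ≤ m)
    (M : Matrix (Fin m → Bool) (Fin m → Bool) ℝ)
    (hM : ∀ x y, M x y = if ham x + ham y = k then 1 else 0) :
    M.rank = k + 1 := by
  apply le_antisymm
  · let A : Matrix (Fin m → Bool) (Fin (k + 1)) ℝ :=
      Matrix.of fun x j => if ham x = j then 1 else 0
    let B : Matrix (Fin (k + 1)) (Fin m → Bool) ℝ :=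
      Matrix.of fun j y => if j + ham y = k then 1 else 0
    have hAB : M = A * B := by
      ext x y
      rw [hM, Matrix.mul_apply]
      by_cases hx : ham x < k + 1
      · rw [Finset.sum_eq_single (⟨ham x, hx⟩ : Fin (k + 1))]
        · simp [A, B]
        · intro j _ hj
          have : ham x ≠ j := fun h => hj (Fin.ext h.symm)
          simp [A, this]
        · simp
      · rw [if_neg (by omega), Finset.sum_eq_zero]
        intro j _
        have : ham x ≠ j := by omega
        simp [A, this]
    rw [hAB]
    simpa using (A.rank_mul_le_left B).trans A.rank_le_card_width
  · let r : Fin (k + 1) → Fin m → Bool := fun j i => decide ((i : ℕ) < j)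
    let c : Fin (k + 1) → Fin m → Bool := fun j i => decide ((i : ℕ) < k - j)
    have hone : M.submatrix r c = 1 := by
      ext i j
      have hr : ham (r i) = i := ham_decide_lt (by omega)
      have hc : ham (c j) = k - j := ham_decide_lt (by omega)
      rw [Matrix.submatrix_apply, hM, hr, hc, Matrix.one_apply]
      exact if_congr (by rw [Fin.ext_iff]; omega) rfl rfl
    simpa [hone] using M.rank_submatrix_le r c
end

section
/- Let m and k be natural numbers with k ≤ m, and let M be the real matrix indexed by pairs of Boolean strings x, y of length m with M(x,y) = 1 if ham(x) + ham(y) = k and 0 otherwise. Then the rank of M is at least k + 1. -/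
/-- The string whose first `w` coordinates are the only ones equal to `true` has weight `w`. -/
theorem ham_decide_val_lt {m w : ℕ} (hw : w ≤ m) :
    ham (fun i : Fin m => decide ((i : ℕ) < w)) = w := by
  simp [ham, Fin.card_filter_val_lt, hw]

/-- The state matrix of the Dicke state has rank at least `k + 1` when `k ≤ m`. -/
theorem dicke_state_matrix_rank_ge (m k : ℕ) (hk : k ≤ m)
    (M : Matrix (Fin m → Bool) (Fin m → Bool) ℝ)
    (hM : ∀ x y, M x y = if ham x + ham y = k then 1 else 0) :
    k + 1 ≤ M.rank := by
  let prefixOnes (w : ℕ) : Fin m → Bool := fun i => decide ((i : ℕ) < w)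
  have hsub : M.submatrix (fun a : Fin (k + 1) => prefixOnes a)
      (fun b : Fin (k + 1) => prefixOnes (k - b)) = 1 := by
    ext a b
    rw [Matrix.submatrix_apply, hM, ham_decide_val_lt (by omega), ham_decide_val_lt (by omega),
      Matrix.one_apply]
    exact if_congr (by rw [Fin.ext_iff]; omega) rfl rfl
  calc k + 1 = (1 : Matrix (Fin (k + 1)) (Fin (k + 1)) ℝ).rank := by
        rw [Matrix.rank_one, Fintype.card_fin]
    _ ≤ M.rank := hsub ▸ M.rank_submatrix_le _ _
end

section
/- Let p ≥ 1, m, and k be natural numbers, and let T be the real-valued function on p-tuples (x_0, …, x_{p−1}) of length-m Boolean strings defined by T(x_0, …, x_{p−1}) = 1 if Σ_{i∈Fin p} ham(x_i) = k and 0 otherwise. Then there exist a natural number r ≤ C(k + p − 1, p − 1) and functions u_{i,j} : (Fin m → Bool) → ℝ for i < r and j < p such that T(x_0, …, x_{p−1}) = Σ_{i<r} Π_{j<p} u_{i,j}(x_j); that is, the p-order Dicke state tensor is a sum of at most C(k+p−1, p−1) rank-one product terms. -/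
/-- The `p`-order Dicke state tensor is a sum of at most `C(k + p - 1, p - 1)`
rank-one product terms. -/
theorem dicke_state_tensor_cprank_le (p m k : ℕ) (hp : 1 ≤ p)
    (T : (Fin p → (Fin m → Bool)) → ℝ)
    (hT : ∀ x, T x = if (∑ i, ham (x i)) = k then 1 else 0) :
    ∃ r ≤ (k + p - 1).choose (p - 1),
      ∃ u : Fin r → Fin p → (Fin m → Bool) → ℝ,
        ∀ x, T x = ∑ i, ∏ j, u i j (x j) := by
  -- One term for each weight profile `P : Fin p → ℕ` with `∑ j, P j = k`.
  let e := (Fintype.equivFin (Sym (Fin p) k)).symm.trans (Sym.equivNatSumOfFintype (Fin p) k)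
  refine ⟨Fintype.card (Sym (Fin p) k), ?_,
    fun i j y => if ham y = (e i).1 j then 1 else 0, fun x => ?_⟩
  · rw [Sym.card_sym_eq_choose, Fintype.card_fin, add_comm p k]
    exact (Nat.choose_symm_of_eq_add (by lia)).le
  · simp only [Fintype.prod_boole, hT]
    split_ifs with h
    · rw [Finset.sum_eq_single (e.symm ⟨fun j => ham (x j), h⟩)]
      · simp
      · intro i _ hi
        refine if_neg fun hx => hi ?_
        rw [Equiv.eq_symm_apply]
        exact Subtype.ext (funext fun j => (hx j).symm)
      · simp
    · refine (Finset.sum_eq_zero fun i _ => if_neg fun hx => h ?_).symm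
      rw [← (e i).2]
      exact Finset.sum_congr rfl fun j _ => hx j
end
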